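/- Let 𝒢 be an ample groupoid which is a group bundle and whose unit space 𝒢⁰ is compact. Then every g ∈ 𝒢 is contained in an invertible compact bisection of 𝒢; in particular, 𝒢 is the union of its invertible compact bisections. -/

import Mathlib

universe u

/-- The algebraic operations of a groupoid (identified with its set of arrows):
a (partially meaningful) composition `gmul` and an inversion `ginv`.  The product
`gmul g h` is only required to behave like composition when `g` and `h` are
composable, i.e. when `src g = rng h`. -/
class GroupoidOps (G : Type u) where
  gmul : G → G → G
  ginv : G → G

namespace GroupoidOps

variable {G : Type u} [GroupoidOps G]

/-- The source map `s g = g⁻¹ g`. -/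
def src (g : G) : G := gmul (ginv g) g

/-- The range map `r g = g g⁻¹`. -/
def rng (g : G) : G := gmul g (ginv g)

/-- The unit space `𝒢⁰`: the set of identity arrows. -/
def unitSpace (G : Type u) [GroupoidOps G] : Set G := {x : G | src x = x}

end GroupoidOps

open GroupoidOps

/-- A topological groupoid: a groupoid `G`, identified with its arrow space, equipped
with a topology such that inversion is continuous and composition is continuous on the
set of composable pairs. -/
class TopologicalGroupoid (G : Type u) extends TopologicalSpace G, GroupoidOps G where
  ginv_ginv : ∀ g : G, ginv (ginv g) = g
  gmul_src : ∀ g : G, gmul g (src g) = g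
  rng_gmul : ∀ g : G, gmul (rng g) g = g
  gmul_assoc : ∀ g h k : G, src g = rng h → src h = rng k →
    gmul (gmul g h) k = gmul g (gmul h k)
  src_gmul : ∀ g h : G, src g = rng h → src (gmul g h) = src h
  rng_gmul_comp : ∀ g h : G, src g = rng h → rng (gmul g h) = rng g
  ginv_gmul : ∀ g h : G, src g = rng h → ginv (gmul g h) = gmul (ginv h) (ginv g)
  ginv_unit : ∀ x : G, src x = x → ginv x = x
  src_src : ∀ g : G, src (src g) = src g
  src_rng : ∀ g : G, src (rng g) = rng g
  continuous_ginv : Continuous (ginv : G → G)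
  continuous_gmul : Continuous fun p : {p : G × G // src p.1 = rng p.2} => gmul p.1.1 p.1.2

/-- An ample groupoid: a topological groupoid (not necessarily Hausdorff) whose unit
space is locally compact, Hausdorff and totally disconnected in the subspace topology,
and whose source map, viewed as a map `G → 𝒢⁰`, is a local homeomorphism. -/
class AmpleGroupoid (G : Type u) extends TopologicalGroupoid G where
  t2_unitSpace : T2Space (unitSpace G)
  locallyCompact_unitSpace : LocallyCompactSpace (unitSpace G)
  totallyDisconnected_unitSpace : TotallyDisconnectedSpace (unitSpace G)
  isLocalHomeomorph_src :
    IsLocalHomeomorph fun g : G => (⟨src g, TopologicalGroupoid.src_src g⟩ : unitSpace G)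

namespace TopologicalGroupoid

variable {G : Type u} [TopologicalGroupoid G]

/-- A bisection: an open subset on which both the source and the range map are injective. -/
def IsBisection (U : Set G) : Prop :=
  IsOpen U ∧ Set.InjOn (src : G → G) U ∧ Set.InjOn (rng : G → G) U

/-- A compact bisection: a bisection which is compact
(quasi-compact and Hausdorff in the subspace topology). -/
def IsCompactBisection (U : Set G) : Prop :=
  IsBisection U ∧ IsCompact U ∧ T2Space U

/-- Setwise inverse `U⁻¹ = { u⁻¹ : u ∈ U }`. -/
def setInv (U : Set G) : Set G := ginv '' U

/-- Setwise product `UV = { uv : u ∈ U, v ∈ V, s(u) = r(v) }`. -/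
def setMul (U V : Set G) : Set G :=
  {x : G | ∃ u ∈ U, ∃ v ∈ V, src u = rng v ∧ x = gmul u v}

/-- A subgroupoid: a subset closed under inversion and (composable) composition. -/
def IsSubgroupoid (H : Set G) : Prop :=
  (∀ g ∈ H, ginv g ∈ H) ∧ ∀ g ∈ H, ∀ h ∈ H, src g = rng h → gmul g h ∈ H

/-- A groupoid is principal if every isotropy element is a unit. -/
def IsPrincipal (G : Type u) [TopologicalGroupoid G] : Prop :=
  ∀ g : G, src g = rng g → g ∈ unitSpace G

/-- The orbit of `x`, namely `r(s⁻¹(x))`. -/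
def orbit (x : G) : Set G := {y : G | ∃ g : G, src g = x ∧ rng g = y}

/-- A subset of the unit space is invariant if it is a union of orbits. -/
def IsInvariant (U : Set G) : Prop := ∀ g : G, src g ∈ U → rng g ∈ U

/-- An inverse semigroup of compact bisections: a nonempty collection of compact
bisections closed under setwise product and setwise inverse. -/
def IsInvSemigroupOfCompactBisections (S : Set (Set G)) : Prop :=
  S.Nonempty ∧ (∀ U ∈ S, IsCompactBisection U) ∧
    (∀ U ∈ S, setInv U ∈ S) ∧ ∀ U ∈ S, ∀ V ∈ S, setMul U V ∈ S

/-- The orbit equivalence relation `𝓡` on the unit space. -/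
def orbitRel (G : Type u) [TopologicalGroupoid G] :
    unitSpace G → unitSpace G → Prop :=
  fun x y => ∃ g : G, src g = (x : G) ∧ rng g = (y : G)

end TopologicalGroupoid

open TopologicalGroupoid

namespace AmpleGroupoid

variable {G : Type u} [AmpleGroupoid G]

/-- The source map with values in the unit space. -/
def srcUnit (g : G) : unitSpace G := ⟨src g, TopologicalGroupoid.src_src g⟩

theorem isLocalHomeomorph_srcUnit : IsLocalHomeomorph (srcUnit : G → unitSpace G) :=
  AmpleGroupoid.isLocalHomeomorph_src

theorem srcUnit_coe (x : unitSpace G) : srcUnit (x : G) = x :=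
  Subtype.ext x.2

/-- If the unit space is compact, every arrow lies on a global continuous section of the
source map. -/
theorem exists_continuous_section (hc : IsCompact (unitSpace G)) (g : G) :
    ∃ σ : unitSpace G → G, Continuous σ ∧ (∀ x, srcUnit (σ x) = x) ∧ g ∈ Set.range σ := by
  classical
  have := AmpleGroupoid.t2_unitSpace (G := G)
  have := AmpleGroupoid.totallyDisconnected_unitSpace (G := G)
  have := isCompact_iff_compactSpace.mp hc
  obtain ⟨e, hge, he⟩ := isLocalHomeomorph_srcUnit g
  obtain ⟨K, hK, hgK, hKe⟩ := compact_exists_isClopen_in_isOpen e.open_target (e.map_source hge)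
  refine ⟨K.piecewise e.symm Subtype.val, ?_, fun x => ?_, e g, ?_⟩
  · refine continuous_piecewise (by simp [hK.frontier_eq]) ?_ continuous_subtype_val.continuousOn
    rw [hK.isClosed.closure_eq]
    exact e.continuousOn_symm.mono hKe
  · by_cases hx : x ∈ K
    · rw [Set.piecewise_eq_of_mem _ _ _ hx, he, e.right_inv (hKe hx)]
    · rw [Set.piecewise_eq_of_notMem _ _ _ hx, srcUnit_coe]
  · rw [Set.piecewise_eq_of_mem _ _ _ hgK, e.left_inv hge]

end AmpleGroupoid

namespace TopologicalGroupoid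

variable {G : Type u} [TopologicalGroupoid G]

theorem src_ginv (g : G) : src (ginv g) = rng g := by
  simp only [src, rng, ginv_ginv]

theorem rng_ginv (g : G) : rng (ginv g) = src g := by
  simp only [src, rng, ginv_ginv]

theorem setInv_setMul_self {U : Set G} (hrng : Set.InjOn (rng : G → G) U) :
    setMul (setInv U) U = src '' U := by
  ext x
  constructor
  · rintro ⟨_, ⟨u, hu, rfl⟩, v, hv, huv, rfl⟩
    obtain rfl := hrng hu hv ((src_ginv u).symm.trans huv)
    exact ⟨u, hu, rfl⟩
  · rintro ⟨u, hu, rfl⟩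
    exact ⟨ginv u, ⟨u, hu, rfl⟩, u, hu, src_ginv u, rfl⟩

theorem setMul_setInv_self {U : Set G} (hsrc : Set.InjOn (src : G → G) U) :
    setMul U (setInv U) = rng '' U := by
  ext x
  constructor
  · rintro ⟨u, hu, _, ⟨v, hv, rfl⟩, huv, rfl⟩
    obtain rfl := hsrc hu hv (huv.trans (rng_ginv v))
    exact ⟨u, hu, rfl⟩
  · rintro ⟨u, hu, rfl⟩
    exact ⟨u, hu, ginv u, ⟨u, hu, rfl⟩, (rng_ginv u).symm, rfl⟩

end TopologicalGroupoid

/-- Let `𝒢` be an ample groupoid which is a group bundle with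
compact unit space.  Then every `g ∈ 𝒢` is contained in an invertible compact
bisection (one with `U⁻¹U = 𝒢⁰ = UU⁻¹`); in particular `𝒢` is the union of its
invertible compact bisections. -/
theorem group_bundle_invertible_bisections (G : Type u) [AmpleGroupoid G]
    (hbundle : ∀ g : G, src g = rng g) (hc : IsCompact (unitSpace G)) :
    ∀ g : G, ∃ U : Set G, IsCompactBisection U ∧ g ∈ U ∧
      setMul (setInv U) U = unitSpace G ∧ setMul U (setInv U) = unitSpace G := by
  intro g
  have := AmpleGroupoid.t2_unitSpace (G := G)
  have := isCompact_iff_compactSpace.mp hc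
  obtain ⟨σ, hσ, hsec, hg⟩ := AmpleGroupoid.exists_continuous_section hc g
  have hsrcσ (x : unitSpace G) : src (σ x) = x := congrArg Subtype.val (hsec x)
  have hemb : Topology.IsOpenEmbedding σ :=
    AmpleGroupoid.isLocalHomeomorph_srcUnit.isOpenEmbedding_of_comp
      (by rw [show AmpleGroupoid.srcUnit ∘ σ = id from funext hsec]; exact .id) hσ
  have hsrc : Set.InjOn (src : G → G) (Set.range σ) := by
    rintro _ ⟨x, rfl⟩ _ ⟨y, rfl⟩ hxy
    rw [hsrcσ, hsrcσ] at hxy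
    rw [Subtype.ext hxy]
  have hrange : src '' Set.range σ = unitSpace G := by
    rw [← Set.range_comp, show src ∘ σ = Subtype.val from funext hsrcσ, Subtype.range_coe]
  have hrs : (rng : G → G) = src := funext fun h => (hbundle h).symm
  have hrng : Set.InjOn (rng : G → G) (Set.range σ) := hrs ▸ hsrc
  refine ⟨Set.range σ, ⟨⟨hemb.isOpen_range, hsrc, hrng⟩, isCompact_range hσ,
    hemb.isEmbedding.toHomeomorph.t2Space⟩, hg, ?_, ?_⟩
  · rw [setInv_setMul_self hrng, hrange]
  · rw [setMul_setInv_self hsrc, hrs, hrange]
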